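/- arXiv:2301.00108 — 2 statements merged into one kernel-verified Lean document; each statement's English description precedes it below -/
import Mathlib

section
/- If an edge e = {i,j} of a finite simple graph G is removed, then only vertices whose core value equals min(C(i,G), C(j,G)) can change core value: for every vertex u, if C(u, G−e) ≠ C(u,G) then C(u,G) = min(C(i,G), C(j,G)). -/
/-- A set `S` of vertices is `k`-supported in `G` if every vertex of `S`
has at least `k` neighbors inside `S`. -/
def kSupported {V : Type*} (G : SimpleGraph V) (k : ℕ) (S : Set V) : Prop :=
  ∀ i ∈ S, k ≤ {j | j ∈ S ∧ G.Adj i j}.ncard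

/-- The `k`-core of `G`: the union of all `k`-supported sets. -/
def kCore {V : Type*} (G : SimpleGraph V) (k : ℕ) : Set V :=
  ⋃₀ {S | kSupported G k S}

/-- The core value `C(i,G)` of a vertex `i`: the largest `k` with `i ∈ V_k(G)`. -/
noncomputable def coreValue {V : Type*} (G : SimpleGraph V) (i : V) : ℕ :=
  sSup {k | i ∈ kCore G k}

/-- The supportive neighbors of `i` at level `k`:
neighbors `j` of `i` with core value at least `k`. -/
def SN {V : Type*} (G : SimpleGraph V) (i : V) (k : ℕ) : Set V :=
  {j | G.Adj i j ∧ k ≤ coreValue G j}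

/-- `SN(i,G)`: abbreviation for `SN(i, C(i,G), G)`. -/
noncomputable def SNc {V : Type*} (G : SimpleGraph V) (i : V) : Set V :=
  SN G i (coreValue G i)

/-- The core strength `CS(i,G) = |SN(i,G)| - C(i,G) + 1`. -/
noncomputable def CS {V : Type*} (G : SimpleGraph V) (i : V) : ℕ :=
  (SNc G i).ncard - coreValue G i + 1

theorem kSupported.mono {V : Type*} {G : SimpleGraph V} {k l : ℕ} {S : Set V}
    (h : kSupported G l S) (hkl : k ≤ l) : kSupported G k S :=
  fun x hx => hkl.trans (h x hx)

theorem kSupported_kCore {V : Type*} [Finite V] (G : SimpleGraph V) (k : ℕ) :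
    kSupported G k (kCore G k) := by
  rintro x ⟨S, hS, hx⟩
  exact (hS x hx).trans
    (Set.ncard_le_ncard (fun y hy => ⟨⟨S, hS, hy.1⟩, hy.2⟩) (Set.toFinite _))

theorem kCore_antitone {V : Type*} (G : SimpleGraph V) : Antitone (kCore G) := by
  rintro k l hkl x ⟨S, hS, hx⟩
  exact ⟨S, hS.mono hkl, hx⟩

theorem mem_kCore_iff_le_coreValue {V : Type*} [Finite V] (G : SimpleGraph V) (k : ℕ) (x : V) :
    x ∈ kCore G k ↔ k ≤ coreValue G x := by
  have hbdd : BddAbove {k | x ∈ kCore G k} :=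
    ⟨Nat.card V, fun l hl => (kSupported_kCore G l x hl).trans (Set.ncard_le_card _)⟩
  have hne : {k | x ∈ kCore G k}.Nonempty :=
    ⟨0, Set.univ, fun _ _ => Nat.zero_le _, Set.mem_univ x⟩
  exact ⟨fun h => le_csSup hbdd h, fun h => kCore_antitone G h (Nat.sSup_mem hne hbdd)⟩

theorem coreValue_mono {V : Type*} [Finite V] {G H : SimpleGraph V} (hGH : G ≤ H) (x : V) :
    coreValue G x ≤ coreValue H x := by
  obtain ⟨S, hS, hx⟩ := (mem_kCore_iff_le_coreValue G _ x).2 le_rfl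
  refine (mem_kCore_iff_le_coreValue H _ x).1 ⟨S, fun y hy => (hS y hy).trans ?_, hx⟩
  exact Set.ncard_le_ncard (fun z hz => ⟨hz.1, hGH hz.2⟩) (Set.toFinite _)

/-- Deleting an edge at `a` keeps `k` neighbors of `a` inside the `k`-core, provided `a` lies in
the `(k + 1)`-core or the other endpoint `b` lies outside the `k`-core. -/
theorem le_ncard_deleteEdges_kCore {V : Type*} [Finite V] (G : SimpleGraph V) {a b : V} {k : ℕ}
    (ha : a ∈ kCore G k) (h : a ∈ kCore G (k + 1) ∨ b ∉ kCore G k) :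
    k ≤ {y | y ∈ kCore G k ∧ (G.deleteEdges {s(a, b)}).Adj a y}.ncard := by
  rcases h with h | h
  · have h1 := kSupported_kCore G (k + 1) a h
    have h2 := Set.pred_ncard_le_ncard_sdiff_singleton
      {y | y ∈ kCore G (k + 1) ∧ G.Adj a y} b
    refine le_trans (by omega) (h2.trans (Set.ncard_le_ncard ?_ (Set.toFinite _)))
    rintro y ⟨⟨hy, hay⟩, hyb⟩
    refine ⟨kCore_antitone G k.le_succ hy, ?_⟩
    rw [SimpleGraph.deleteEdges_adj]
    exact ⟨hay, fun hmem => hyb (Sym2.congr_right.1 hmem)⟩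
  · refine (kSupported_kCore G k a ha).trans (Set.ncard_le_ncard ?_ (Set.toFinite _))
    rintro y ⟨hy, hay⟩
    refine ⟨hy, ?_⟩
    rw [SimpleGraph.deleteEdges_adj]
    refine ⟨hay, fun hmem => h ?_⟩
    rwa [← Sym2.congr_right.1 hmem]

/-- The `k`-core stays `k`-supported after deleting the edge `{i, j}` unless `k` is the minimum of
the core values of `i` and `j`. -/
theorem kSupported_deleteEdges_kCore {V : Type*} [Finite V] (G : SimpleGraph V) {i j : V} {k : ℕ}
    (hk : k ≠ min (coreValue G i) (coreValue G j)) :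
    kSupported (G.deleteEdges {s(i, j)}) k (kCore G k) := by
  intro x hx
  by_cases hxi : x = i
  · subst hxi
    apply le_ncard_deleteEdges_kCore G hx
    simp only [mem_kCore_iff_le_coreValue] at hx ⊢
    omega
  by_cases hxj : x = j
  · subst hxj
    rw [Sym2.eq_swap]
    apply le_ncard_deleteEdges_kCore G hx
    simp only [mem_kCore_iff_le_coreValue] at hx ⊢
    omega
  refine (kSupported_kCore G k x hx).trans (Set.ncard_le_ncard ?_ (Set.toFinite _))
  rintro y ⟨hy, hxy⟩
  refine ⟨hy, ?_⟩
  rw [SimpleGraph.deleteEdges_adj]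
  refine ⟨hxy, fun hmem => ?_⟩
  rcases Sym2.mem_iff.1 ((Set.mem_singleton_iff.1 hmem) ▸ Sym2.mem_mk_left x y) with h | h
  exacts [hxi h, hxj h]

theorem stmt_6 {V : Type*} [Fintype V] (G : SimpleGraph V) (i j : V)
    (hij : G.Adj i j) (u : V)
    (hchange : coreValue (G.deleteEdges {s(i, j)}) u ≠ coreValue G u) :
    coreValue G u = min (coreValue G i) (coreValue G j) := by
  by_contra hk
  refine hchange (le_antisymm (coreValue_mono (G.deleteEdges_le _) u) ?_)
  exact (mem_kCore_iff_le_coreValue _ _ u).1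
    ⟨_, kSupported_deleteEdges_kCore G hk, (mem_kCore_iff_le_coreValue G _ u).2 le_rfl⟩
end

section
/- Let e = {i,j} be an edge of a finite simple graph G. If removing e changes the core value of some vertex (i.e., there exists u with C(u, G−e) ≠ C(u,G)), then both of the following hold: (i) min(CS(i,G), CS(j,G)) = 1, and (ii) the integer product (CS(i,G) − CS(j,G)) · (C(i,G) − C(j,G)) is nonnegative. -/
theorem kCore_mono {V : Type*} [Finite V] {G H : SimpleGraph V} (h : G ≤ H) (k : ℕ) :
    kCore G k ⊆ kCore H k := by
  rintro v ⟨S, hS, hv⟩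
  exact ⟨S, fun w hw =>
    (hS w hw).trans (Set.ncard_le_ncard (fun x hx => ⟨hx.1, h hx.2⟩)), hv⟩

theorem mem_kCore_iff {V : Type*} [Finite V] (G : SimpleGraph V) (v : V) (k : ℕ) :
    v ∈ kCore G k ↔ k ≤ coreValue G v := by
  have hbdd : BddAbove {k | v ∈ kCore G k} := by
    refine ⟨(Set.univ : Set V).ncard, ?_⟩
    rintro k ⟨S, hS, hv⟩
    exact (hS v hv).trans (Set.ncard_le_ncard (Set.subset_univ _))
  have hne : {k | v ∈ kCore G k}.Nonempty :=
    ⟨0, Set.univ, fun _ _ => Nat.zero_le _, Set.mem_univ v⟩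
  exact ⟨fun h => le_csSup hbdd h, fun h => kCore_antitone G h (Nat.sSup_mem hne hbdd)⟩

theorem le_ncard_SN {V : Type*} [Finite V] (G : SimpleGraph V) (v : V) {k : ℕ}
    (hk : k ≤ coreValue G v) : k ≤ (SN G v k).ncard := by
  refine (kSupported_kCore G k v ((mem_kCore_iff G v k).2 hk)).trans
    (Set.ncard_le_ncard fun w hw => ⟨hw.2, (mem_kCore_iff G w k).1 hw.1⟩)

theorem lt_ncard_SN_of_lt {V : Type*} [Finite V] (G : SimpleGraph V) (v : V) {k : ℕ}
    (hk : k < coreValue G v) : k < (SN G v k).ncard :=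
  hk.trans_le ((le_ncard_SN G v le_rfl).trans
    (Set.ncard_le_ncard fun _ hw => ⟨hw.1, hk.le.trans hw.2⟩))

theorem lt_ncard_SN_of_CS_ne_one {V : Type*} [Finite V] (G : SimpleGraph V) (v : V)
    (h : CS G v ≠ 1) {k : ℕ} (hk : k ≤ coreValue G v) : k < (SN G v k).ncard := by
  rcases hk.lt_or_eq with hk | rfl
  · exact lt_ncard_SN_of_lt G v hk
  · unfold CS SNc at h
    omega

/-- Deleting an edge preserves all core values if, at every level up to the smaller core value of
its endpoints, both endpoints have a supportive neighbor to spare. -/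
theorem coreValue_deleteEdges_eq {V : Type*} [Finite V] (G : SimpleGraph V) (i j : V)
    (h : ∀ k, k ≤ coreValue G i → k ≤ coreValue G j →
      k < (SN G i k).ncard ∧ k < (SN G j k).ncard) (u : V) :
    coreValue (G.deleteEdges {s(i, j)}) u = coreValue G u := by
  apply le_antisymm
  · rw [← mem_kCore_iff]
    exact kCore_mono (G.deleteEdges_le _) _ ((mem_kCore_iff _ _ _).2 le_rfl)
  · rw [← mem_kCore_iff]
    generalize hk : coreValue G u = k
    have spare : ∀ x y : V, k < (SN G x k).ncard →
        k ≤ (SN G x k \ {y}).ncard := fun x y hx => by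
      have := Set.ncard_le_ncard_sdiff_add_ncard (SN G x k) {y}
      rw [Set.ncard_singleton] at this
      omega
    refine ⟨{w | k ≤ coreValue G w}, fun v hv => ?_, hk.ge⟩
    have hv : k ≤ coreValue G v := hv
    by_cases hi : v = i ∧ k ≤ coreValue G j
    · obtain ⟨rfl, hj⟩ := hi
      refine (spare v j (h k hv hj).1).trans (Set.ncard_le_ncard ?_)
      rintro w ⟨⟨hw, hkw⟩, hwj⟩
      refine ⟨hkw, ?_⟩
      have := hw.ne
      simp only [SimpleGraph.deleteEdges_adj, Set.mem_singleton_iff, Sym2.eq_iff] at hwj ⊢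
      grind
    by_cases hj : v = j ∧ k ≤ coreValue G i
    · obtain ⟨rfl, hki⟩ := hj
      refine (spare v i (h k hki hv).2).trans (Set.ncard_le_ncard ?_)
      rintro w ⟨⟨hw, hkw⟩, hwj⟩
      refine ⟨hkw, ?_⟩
      have := hw.ne
      simp only [SimpleGraph.deleteEdges_adj, Set.mem_singleton_iff, Sym2.eq_iff] at hwj ⊢
      grind
    · refine (le_ncard_SN G v hv).trans (Set.ncard_le_ncard ?_)
      rintro w ⟨hw, hkw⟩
      refine ⟨hkw, ?_⟩
      simp only [SimpleGraph.deleteEdges_adj, Set.mem_singleton_iff, Sym2.eq_iff]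
      grind

theorem stmt_9 {V : Type*} [Fintype V] (G : SimpleGraph V) (i j : V)
    (hij : G.Adj i j)
    (hchange : ∃ u : V,
      coreValue (G.deleteEdges {s(i, j)}) u ≠ coreValue G u) :
    min (CS G i) (CS G j) = 1 ∧
      0 ≤ ((CS G i : ℤ) - (CS G j : ℤ)) *
          ((coreValue G i : ℤ) - (coreValue G j : ℤ)) := by
  obtain ⟨u, hu⟩ := hchange
  have hi1 : 1 ≤ CS G i := Nat.le_add_left _ _
  have hj1 : 1 ≤ CS G j := Nat.le_add_left _ _
  rcases lt_trichotomy (coreValue G i) (coreValue G j) with hlt | heq | hlt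
  · have hi : CS G i = 1 := by
      by_contra hi
      exact hu (coreValue_deleteEdges_eq G i j (fun k hki _ =>
        ⟨lt_ncard_SN_of_CS_ne_one G i hi hki, lt_ncard_SN_of_lt G j (hki.trans_lt hlt)⟩) u)
    exact ⟨by omega, mul_nonneg_of_nonpos_of_nonpos (by omega) (by omega)⟩
  · refine ⟨?_, by simp [heq]⟩
    by_contra hmin
    have hi : CS G i ≠ 1 := by omega
    have hj : CS G j ≠ 1 := by omega
    exact hu (coreValue_deleteEdges_eq G i j (fun k hki hkj =>
      ⟨lt_ncard_SN_of_CS_ne_one G i hi hki, lt_ncard_SN_of_CS_ne_one G j hj hkj⟩) u)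
  · have hj : CS G j = 1 := by
      by_contra hj
      exact hu (coreValue_deleteEdges_eq G i j (fun k _ hkj =>
        ⟨lt_ncard_SN_of_lt G i (hkj.trans_lt hlt), lt_ncard_SN_of_CS_ne_one G j hj hkj⟩) u)
    exact ⟨by omega, mul_nonneg (by omega) (by omega)⟩
end
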